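/- If N ∈ ℕ and B(N) ≠ 0, then N is represented by the ternary expansion coming from identity (2.8): there exist nonnegative integers x and i, an integer j with |j| ≤ i, and ε, δ ∈ {0, 1}, such that N = x² + i(3i+1)/2 − j(j−1)/2 + xj + ε(2x+1) + δ(2i+1). -/

import Mathlib

open Classical in
/-- `Abar k m n` = (number of partitions of `n` satisfying: every part ≤ 2k; the part `k`
appears at least once and at most twice; every `j` with `1 ≤ j < k` appears at least twice
and at most thrice; the number of parts in `{k+1, …, 2k}` equals `m`; in which the number
of parts `≤ k` is odd) minus (the number of such partitions in which the number of parts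
`≤ k` is even). -/
noncomputable def Abar (k m n : ℕ) : ℤ :=
  ∑ p ∈ Finset.univ.filter (fun p : Nat.Partition n =>
      (∀ x ∈ p.parts, x ≤ 2 * k) ∧
      1 ≤ Multiset.count k p.parts ∧ Multiset.count k p.parts ≤ 2 ∧
      (∀ j, 1 ≤ j → j < k → 2 ≤ Multiset.count j p.parts ∧ Multiset.count j p.parts ≤ 3) ∧
      Multiset.card (p.parts.filter (fun x => k + 1 ≤ x ∧ x ≤ 2 * k)) = m),
    (-1 : ℤ) ^ (Multiset.card (p.parts.filter (fun x => x ≤ k)) + 1)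

/-- `B(n) = ∑_{k,m≥0} Ā_{k,m}(n)`; the sum is finite since `Ā_{k,m}(n) = 0`
whenever `k > n` or `m > n`. -/
noncomputable def B (n : ℕ) : ℤ :=
  ∑ k ∈ Finset.range (n + 1), ∑ m ∈ Finset.range (n + 1), Abar k m n

section Expansion

open PowerSeries Finset

/-- The `q`-factorial-type product `(q; q)_n = ∏_{i=1}^n (1 - q^i)`. -/
noncomputable def qfac (n : ℕ) : ℤ⟦X⟧ := ∏ i ∈ range n, (1 - X ^ (i + 1))

/-- The inverse of `(q; q)_n`. -/
noncomputable def qinv (n : ℕ) : ℤ⟦X⟧ := invOfUnit (qfac n) 1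

@[simp] lemma qfac_zero : qfac 0 = 1 := by simp [qfac]

lemma qfac_succ (n : ℕ) : qfac (n + 1) = qfac n * (1 - X ^ (n + 1)) := by
  simp [qfac, prod_range_succ]

lemma qfac_mul_qinv (n : ℕ) : qfac n * qinv n = 1 :=
  mul_invOfUnit _ _ (by simp [qfac, map_prod])

@[simp] lemma qinv_zero : qinv 0 = 1 := by simpa using qfac_mul_qinv 0

lemma qinv_eq (n : ℕ) : qinv n = qinv (n + 1) * (1 - X ^ (n + 1)) := by
  have h := qfac_mul_qinv n
  have h' := qfac_mul_qinv (n + 1)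
  rw [qfac_succ] at h'
  linear_combination qinv (n + 1) * (1 - X ^ (n + 1)) * h - qinv n * h'

lemma triangle_succ (n : ℕ) : (n + 1) * (n + 2) / 2 = n * (n + 1) / 2 + (n + 1) := by
  have : (n + 1) * (n + 2) = n * (n + 1) + 2 * (n + 1) := by ring
  omega

/-! ### The expansion of `(q; q)_n / (q; q)_{2n}` -/

/-- The first `L` terms of the series expanding `(q; q)_n`:
`∑_y q^(y² + ny) (1 - q^(2n + 2y + 1)) (q; q)_{2n+y} / (q; q)_y`. -/
noncomputable def wpSum (n L : ℕ) : ℤ⟦X⟧ :=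
  ∑ y ∈ range L, X ^ (y ^ 2 + n * y) * (1 - X ^ (2 * n + 2 * y + 1)) * qfac (2 * n + y) * qinv y

lemma wpSum_rec (n L : ℕ) :
    wpSum (n + 1) L - (1 - X ^ (n + 1)) * wpSum n L =
      X ^ (L ^ 2 + n * L) * qfac (2 * n + L) * qinv L * (1 - X ^ L) *
        (1 - X ^ (n + 1) - X ^ (n + 1 + L) + X ^ (3 * n + 2 * L + 2)) := by
  induction L with
  | zero => simp [wpSum]
  | succ y ih =>
    simp only [wpSum, sum_range_succ] at ih ⊢
    have e1 : 2 * (n + 1) + y = 2 * n + y + 1 + 1 := by ring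
    have e2 : 2 * n + (y + 1) = 2 * n + y + 1 := by ring
    rw [e1, e2, qfac_succ (2 * n + y + 1), qfac_succ (2 * n + y)]
    rw [qinv_eq y] at ih ⊢
    linear_combination ih

lemma wpSum_zero (L : ℕ) : wpSum 0 L = 1 - X ^ (L ^ 2) := by
  induction L with
  | zero => simp [wpSum]
  | succ y ih =>
    simp only [wpSum, sum_range_succ] at ih ⊢
    rw [ih]
    simp only [mul_zero, zero_mul, zero_add, add_zero]
    linear_combination (X ^ (y ^ 2) * (1 - X ^ (2 * y + 1))) * qfac_mul_qinv y

lemma X_pow_dvd_qinv_mul_wpSum_sub_one (n L : ℕ) :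
    (X : ℤ⟦X⟧) ^ L ∣ qinv n * wpSum n L - 1 := by
  induction n with
  | zero => 
    rw [wpSum_zero]
    simpa using pow_dvd_pow _ (Nat.le_self_pow two_ne_zero L)
  | succ n ih =>
    have h := wpSum_rec n L
    have : qinv (n + 1) * wpSum (n + 1) L - 1 = (qinv n * wpSum n L - 1) + 
      X ^ (L ^ 2 + n * L) * (qinv (n + 1) * qfac (2 * n + L) * qinv L * (1 - X ^ L) *
        (1 - X ^ (n + 1) - X ^ (n + 1 + L) + X ^ (3 * n + 2 * L + 2))) := by
      rw [qinv_eq n]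
      linear_combination qinv (n + 1) * h
    rw [this]
    exact dvd_add ih (Dvd.dvd.mul_right (pow_dvd_pow _
      (le_add_right (Nat.le_self_pow two_ne_zero L))) _)

/-! ### A partial theta function -/

/-- The first `L` terms of `∑_m (-1)^m q^(m(m+1)/2 + mr) (q; q)_{m+r} / ((q; q)_m (q; q)_{m+2r+1})`,
a series whose value is `1`. -/
noncomputable def unitSum (r L : ℕ) : ℤ⟦X⟧ :=
  ∑ m ∈ range L, (-1) ^ m * X ^ (m * (m + 1) / 2 + m * r) * qfac (m + r) * qinv m *
    qinv (m + 2 * r + 1)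

lemma unitSum_rec (r L : ℕ) :
    unitSum (r + 1) L - unitSum r L =
      (-1) ^ L * X ^ (L * (L + 1) / 2 + L * r) * qfac (L + r) * qinv L * qinv (L + 2 * r + 2) *
        (1 - X ^ L) * (1 - X ^ (L + r + 1) - X ^ (L + 2 * r + 2)) := by
  induction L with
  | zero => simp [unitSum]
  | succ m ih =>
    simp only [unitSum, sum_range_succ] at ih ⊢
    have e1 : m + 2 * (r + 1) + 1 = m + 2 * r + 1 + 1 + 1 := by ring
    have e2 : m + (r + 1) = m + r + 1 := by ring
    have e3 : m + 1 + r = m + r + 1 := by ring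
    have e4 : m + 1 + 2 * r + 2 = m + 2 * r + 1 + 1 + 1 := by ring
    have e5 : m + 2 * r + 2 = m + 2 * r + 1 + 1 := by ring
    rw [e5] at ih
    rw [e1, e2, e3, e4, qfac_succ (m + r), triangle_succ, qinv_eq (m + 2 * r + 1)]
    rw [qinv_eq (m + 2 * r + 1 + 1)] at ih ⊢
    rw [qinv_eq m] at ih ⊢
    linear_combination ih

lemma unitSum_zero (L : ℕ) :
    unitSum 0 L = 1 - (-1) ^ L * X ^ (L * (L + 1) / 2) * qinv L := by
  induction L with
  | zero => simp [unitSum]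
  | succ m ih =>
    simp only [unitSum, sum_range_succ] at ih ⊢
    rw [ih, triangle_succ]
    simp only [mul_zero, add_zero]
    have h := qfac_mul_qinv m
    linear_combination ((-1) ^ m * X ^ (m * (m + 1) / 2) * qinv (m + 1)) * h
       - ((-1) ^ m * X ^ (m * (m + 1) / 2)) * qinv_eq m

lemma le_triangle (L : ℕ) : L ≤ L * (L + 1) / 2 := by
  rcases L with _ | L
  · simp
  · rw [triangle_succ]; omega

lemma X_pow_dvd_unitSum_sub_one (r L : ℕ) : (X : ℤ⟦X⟧) ^ L ∣ unitSum r L - 1 := by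
  induction r with
  | zero =>
    refine ⟨-((-1) ^ L * X ^ (L * (L + 1) / 2 - L) * qinv L), ?_⟩
    rw [unitSum_zero]
    obtain ⟨d, hd⟩ := Nat.exists_eq_add_of_le (le_triangle L)
    rw [hd]
    simp only [Nat.add_sub_cancel_left]
    ring
  | succ r ih =>
    obtain ⟨d, hd⟩ := Nat.exists_eq_add_of_le (le_triangle L)
    obtain ⟨c, hc⟩ := ih
    have h := unitSum_rec r L
    rw [hd] at h
    refine ⟨c + (-1) ^ L * X ^ (d + L * r) * qfac (L + r) * qinv L * qinv (L + 2 * r + 2) *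
        (1 - X ^ L) * (1 - X ^ (L + r + 1) - X ^ (L + 2 * r + 2)), ?_⟩
    linear_combination h + hc

/-- The first `L` terms of `∑_m (-1)^m q^(m(m+1)/2 + mk) (q; q)_{m+k} / ((q; q)_m (q; q)_{m+2k})`,
a series whose value is a partial theta function. -/
noncomputable def thetaSum (k L : ℕ) : ℤ⟦X⟧ :=
  ∑ m ∈ range L, (-1) ^ m * X ^ (m * (m + 1) / 2 + m * k) * qfac (m + k) * qinv m *
    qinv (m + 2 * k)

lemma thetaSum_rec (k L : ℕ) :
    thetaSum k (L + 1) + X ^ (3 * k + 2) * thetaSum (k + 1) L =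
      (1 - X ^ (2 * k + 1)) * unitSum k (L + 1) := by
  induction L with
  | zero =>
    simp only [thetaSum, unitSum, zero_add, sum_range_one, sum_range_zero]
    rw [qinv_eq (2 * k)]
    simp
    ring
  | succ m ih =>
    have e1 : m + 1 + 2 * k = m + 2 * k + 1 := by ring
    have e2 : m + (k + 1) = m + k + 1 := by ring
    have e3 : m + 1 + k = m + k + 1 := by ring
    have e4 : m + 2 * (k + 1) = m + 2 * k + 1 + 1 := by ring
    rw [thetaSum, sum_range_succ _ (m + 1), ← thetaSum, thetaSum.eq_def (k + 1), sum_range_succ _ m,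
      ← thetaSum, unitSum, sum_range_succ _ (m + 1), ← unitSum, triangle_succ, e1, e2, e3, e4,
      qinv_eq (m + 2 * k + 1), qinv_eq m]
    linear_combination ih

lemma coeff_thetaSum_ne_zero (n k L : ℕ) (hL : n < L) (h : coeff n (thetaSum k L) ≠ 0) :
    ∃ i δ : ℕ, k ≤ i ∧ δ ≤ 1 ∧
      2 * n + k * (3 * k + 1) = i * (3 * i + 1) + 2 * δ * (2 * i + 1) := by
  induction n using Nat.strong_induction_on generalizing k L with
  | _ n ih =>
  obtain ⟨L, rfl⟩ := Nat.exists_eq_add_of_lt hL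
  rw [show n + L + 1 = (n + L) + 1 from rfl] at h
  obtain ⟨c, hc⟩ := X_pow_dvd_unitSum_sub_one k (n + L + 1)
  have hr : thetaSum k (n + L + 1) =
      1 - X ^ (2 * k + 1) - X ^ (3 * k + 2) * thetaSum (k + 1) (n + L)
      + X ^ (n + L + 1) * (c * (1 - X ^ (2 * k + 1))) := by
    linear_combination thetaSum_rec k (n + L) + (1 - X ^ (2 * k + 1)) * hc
  by_cases h0 : n = 0
  · exact ⟨k, 0, le_rfl, by simp, by simp [h0]⟩
  by_cases h1 : n = 2 * k + 1
  · exact ⟨k, 1, le_rfl, le_rfl, by rw [h1]; ring⟩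
  rw [hr] at h
  simp only [map_add, map_sub, coeff_one, h0, coeff_X_pow, h1, coeff_X_pow_mul', if_false,
    show ¬ (n + L + 1 ≤ n) by omega] at h
  by_cases h2 : 3 * k + 2 ≤ n
  · rw [if_pos h2] at h
    obtain ⟨i, δ, hi, hδ, he⟩ := ih (n - (3 * k + 2)) (by omega) (k + 1) (n + L) (by omega)
      (by simpa using h)
    refine ⟨i, δ, by omega, hδ, ?_⟩
    obtain ⟨d, rfl⟩ := Nat.exists_eq_add_of_le h2
    rw [Nat.add_sub_cancel_left] at he
    linarith
  · simp [h2] at h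

/-! ### The `q`-binomial theorem and the finite Jacobi triple product -/

lemma prod_sub_mul_X_pow (u y : ℤ⟦X⟧) (N : ℕ) :
    ∏ s ∈ range N, (u - y * X ^ s) = qfac N * ∑ p ∈ antidiagonal N,
      (-1) ^ p.2 * X ^ (p.2 * (p.2 - 1) / 2) * y ^ p.2 * u ^ p.1 * qinv p.1 * qinv p.2 := by
  induction N with
  | zero => simp
  | succ N ih =>
    have hs (f : ℕ × ℕ → ℤ⟦X⟧) : (1 - X ^ (N + 1)) * ∑ p ∈ antidiagonal (N + 1), f p =
        ∑ p ∈ antidiagonal (N + 1), (1 - X ^ p.1) * f p +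
          ∑ p ∈ antidiagonal (N + 1), X ^ p.1 * (1 - X ^ p.2) * f p := by
      rw [← sum_add_distrib, mul_sum]
      refine sum_congr rfl fun p hp => ?_
      rw [← mem_antidiagonal.1 hp, pow_add]
      ring
    rw [prod_range_succ, ih, qfac_succ, mul_assoc (qfac N) (1 - _), hs,
      Nat.sum_antidiagonal_succ, Nat.sum_antidiagonal_succ']
    simp only [pow_zero, sub_self, zero_mul, mul_zero, zero_add]
    rw [mul_assoc, sum_mul, ← sum_add_distrib]
    congr 1
    refine sum_congr rfl fun p hp => ?_
    have ht : (p.2 + 1) * (p.2 + 1 - 1) / 2 = p.2 * (p.2 - 1) / 2 + p.2 := by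
      rcases p.2 with _ | t
      · simp
      · have : (t + 1 + 1) * (t + 1 + 1 - 1) = (t + 1) * (t + 1 - 1) + 2 * (t + 1) := by
          simp only [Nat.add_sub_cancel]; ring
        omega
    rw [ht, ← mem_antidiagonal.1 hp, qinv_eq p.1, qinv_eq p.2]
    ring

lemma qfac_mul_prod (a b : ℕ) :
    qfac a * ∏ s ∈ range b, (1 - X ^ (a + 1 + s)) = qfac (a + b) := by
  induction b with
  | zero => simp
  | succ b ih =>
    rw [prod_range_succ, ← mul_assoc, ih, ← add_assoc, qfac_succ]
    ring

lemma prod_X_pow_sub_X_pow (x n : ℕ) :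
    ∏ s ∈ range (2 * n), ((X : ℤ⟦X⟧) ^ n - X ^ (x + 1) * X ^ s) =
      if n ≤ x then X ^ (2 * n ^ 2) * qfac (x + n) * qinv (x - n) else 0 := by
  split_ifs with h
  · obtain ⟨y, rfl⟩ := Nat.exists_eq_add_of_le h
    have : ∀ s ∈ range (2 * n), (X : ℤ⟦X⟧) ^ n - X ^ (n + y + 1) * X ^ s =
        X ^ n * (1 - X ^ (y + 1 + s)) := fun s _ => by ring
    rw [prod_congr rfl this, prod_mul_distrib, prod_const, card_range, Nat.add_sub_cancel_left,
      show n + y + n = y + 2 * n by ring, ← qfac_mul_prod]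
    linear_combination -(X ^ (2 * n ^ 2) * ∏ s ∈ range (2 * n), (1 - X ^ (y + 1 + s)))
      * qfac_mul_qinv y
  · refine prod_eq_zero (i := n - x - 1) (mem_range.2 (by omega)) ?_
    rw [← pow_add, sub_eq_zero]
    congr 1
    omega

/-- The `j`-th term of the finite Jacobi triple product, with
`(q; q)_n / ((q; q)_{n-j} (q; q)_{n+j})` in place of the `q`-binomial coefficient. -/
noncomputable def tripleTerm (x n : ℕ) (j : ℤ) : ℤ⟦X⟧ :=
  (-1) ^ (n + j.natAbs) * X ^ (x ^ 2 + x * j + n * (n + 1) / 2 + j * (j + 1) / 2).toNat *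
    qfac n * qinv (n - j).toNat * qinv (n + j).toNat

lemma two_mul_ediv_two (j : ℤ) : 2 * (j * (j + 1) / 2) = j * (j + 1) :=
  Int.mul_ediv_cancel' (Int.even_mul_succ_self j).two_dvd

lemma sum_tripleTerm (x n : ℕ) :
    ∑ j ∈ Icc (-(n : ℤ)) n, tripleTerm x n j = if n ≤ x then
      X ^ (n ^ 2 + (x - n) ^ 2 + n * (x - n)) * qfac n * qfac (x + n) * qinv (x - n) *
        qinv (2 * n) else 0 := by
  have key : X ^ (n ^ 2 + n * x) * ∑ j ∈ Icc (-(n : ℤ)) n, tripleTerm x n j =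
      X ^ (x ^ 2) * qfac n * qinv (2 * n) *
        ∏ s ∈ range (2 * n), ((X : ℤ⟦X⟧) ^ n - X ^ (x + 1) * X ^ s) := by
    have h1 : X ^ (x ^ 2) * qfac n * qinv (2 * n) *
        ∏ s ∈ range (2 * n), ((X : ℤ⟦X⟧) ^ n - X ^ (x + 1) * X ^ s) =
        X ^ (x ^ 2) * qfac n * ∑ p ∈ antidiagonal (2 * n),
          (-1) ^ p.2 * X ^ (p.2 * (p.2 - 1) / 2) * (X ^ (x + 1)) ^ p.2 * (X ^ n) ^ p.1 *
            qinv p.1 * qinv p.2 := by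
      rw [prod_sub_mul_X_pow, ← mul_assoc, mul_assoc _ (qinv _), mul_comm (qinv _),
        qfac_mul_qinv, mul_one]
    rw [h1, mul_sum, mul_sum]
    refine sum_bij' (fun (j : ℤ) _ => ((n - j).toNat, (n + j).toNat))
      (fun (p : ℕ × ℕ) _ => (p.2 : ℤ) - n)
      ?_ ?_ ?_ ?_ ?_
    · intro j hj
      rw [mem_Icc] at hj
      rw [HasAntidiagonal.mem_antidiagonal]
      omega
    · intro p hp
      rw [HasAntidiagonal.mem_antidiagonal] at hp
      rw [mem_Icc]
      omega
    · intro j hj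
      rw [mem_Icc] at hj
      simp only
      omega
    · intro p hp
      rw [HasAntidiagonal.mem_antidiagonal] at hp
      ext <;> simp only <;> omega
    · intro j hj
      rw [mem_Icc] at hj
      obtain ⟨t, ht⟩ : ∃ t : ℕ, n + j = t := ⟨(n + j).toNat, by omega⟩
      obtain ⟨s, hs⟩ : ∃ s : ℕ, n - j = s := ⟨(n - j).toNat, by omega⟩
      simp only [tripleTerm, ht, hs, Int.toNat_natCast]
      have hsign : (-1 : ℤ⟦X⟧) ^ (n + j.natAbs) = (-1) ^ t :=
        neg_one_pow_congr (by rw [Nat.even_iff, Nat.even_iff]; omega)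
      have hE : n ^ 2 + n * x + (x ^ 2 + x * j + n * (n + 1) / 2 + j * (j + 1) / 2).toNat =
          x ^ 2 + (t * (t - 1) / 2 + (x + 1) * t + n * s) := by
        have a1 := two_mul_ediv_two j
        have a2 := two_mul_ediv_two n
        have a3 : (2 : ℤ) * (t * (t - 1) / 2 : ℕ) = t * (t - 1) := by
          rcases t with _ | t
          · simp
          · have := Nat.two_mul_div_two_of_even (Nat.even_mul_pred_self (t + 1))
            zify at this
            simpa using this
        have a4 : 0 ≤ (x : ℤ) ^ 2 + x * j + n * (n + 1) / 2 + j * (j + 1) / 2 := by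
          have : 0 ≤ 2 * ((x : ℤ) ^ 2 + x * j + n * (n + 1) / 2 + j * (j + 1) / 2) := by
            have : j ^ 2 ≤ n ^ 2 := sq_le_sq' (by omega) (by omega)
            nlinarith [sq_nonneg ((x : ℤ) + j), sq_nonneg (x : ℤ)]
          omega
        obtain ⟨e, he⟩ := Int.eq_ofNat_of_zero_le a4
        rw [he, Int.toNat_natCast]
        generalize t * (t - 1) / 2 = T at *
        generalize j * (j + 1) / 2 = J at *
        generalize (n : ℤ) * (n + 1) / 2 = K at *
        zify
        have b1 : j = t - n := by omega
        have b2 : (s : ℤ) = 2 * n - t := by omega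
        rw [b2]
        subst b1
        linarith
      rw [hsign]
      have h2 := congrArg (fun e => (X : ℤ⟦X⟧) ^ e) hE
      simp only [pow_add] at h2
      rw [← pow_mul, ← pow_mul]
      linear_combination (-1) ^ t * qfac n * qinv s * qinv t * h2
  rw [prod_X_pow_sub_X_pow] at key
  refine mul_left_cancel₀ (pow_ne_zero (n ^ 2 + n * x) X_ne_zero) (key.trans ?_)
  split_ifs with h
  · obtain ⟨y, rfl⟩ := Nat.exists_eq_add_of_le h
    rw [Nat.add_sub_cancel_left]
    ring
  · simp

lemma sum_tripleTerm_left (x M : ℕ) (j : ℤ) :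
    ∑ n ∈ Icc j.natAbs M, tripleTerm x n j =
      X ^ (x ^ 2 + x * j + j * (j + 1) / 2 + j.natAbs * (j.natAbs + 1) / 2).toNat *
        thetaSum j.natAbs (M + 1 - j.natAbs) := by
  rw [thetaSum, mul_sum, ← Finset.Ico_add_one_right_eq_Icc, sum_Ico_eq_sum_range]
  refine sum_congr rfl fun m _ => ?_
  have hq : qinv ((j.natAbs + m : ℕ) - j).toNat * qinv ((j.natAbs + m : ℕ) + j).toNat =
      qinv m * qinv (m + 2 * j.natAbs) := by
    rcases le_total 0 j with h | h
    · congr 2 <;> omega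
    · rw [mul_comm]
      congr 2 <;> omega
  have hE : (x ^ 2 + x * j + (j.natAbs + m : ℕ) * ((j.natAbs + m : ℕ) + 1) / 2 +
      j * (j + 1) / 2).toNat =
      (x ^ 2 + x * j + j * (j + 1) / 2 + j.natAbs * (j.natAbs + 1) / 2).toNat +
        (m * (m + 1) / 2 + m * j.natAbs) := by
    have a1 := two_mul_ediv_two j
    have a2 := two_mul_ediv_two j.natAbs
    have a3 := two_mul_ediv_two m
    have a4 := two_mul_ediv_two (j.natAbs + m : ℕ)
    have a5 : 0 ≤ (x : ℤ) ^ 2 + x * j + j * (j + 1) / 2 + j.natAbs * (j.natAbs + 1) / 2 := by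
      have : 0 ≤ 2 * ((x : ℤ) ^ 2 + x * j + j * (j + 1) / 2 + j.natAbs * (j.natAbs + 1) / 2) := by
        have := Int.natAbs_sq j
        nlinarith [sq_nonneg ((x : ℤ) + j), sq_nonneg (x : ℤ), neg_le_abs j,
          Int.natCast_natAbs j]
      omega
    have a6 : (2 : ℤ) * (m * (m + 1) / 2 : ℕ) = m * (m + 1) := by exact_mod_cast a3
    obtain ⟨e, he⟩ := Int.eq_ofNat_of_zero_le a5
    rw [Nat.cast_add] at a4 ⊢
    generalize m * (m + 1) / 2 = T at *
    generalize j * (j + 1) / 2 = J at *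
    generalize j.natAbs = k at *
    generalize ((k : ℤ) + m) * (k + m + 1) / 2 = K at *
    generalize (k : ℤ) * (k + 1) / 2 = K' at *
    rw [he, Int.toNat_natCast, show (x : ℤ) ^ 2 + x * j + K + J = (e + (T + m * k) : ℕ) by
      push_cast; linarith, Int.toNat_natCast]
  rw [tripleTerm, hE, mul_assoc _ (qinv _), hq, show j.natAbs + m + j.natAbs =
    m + 2 * j.natAbs by ring, pow_add (-1 : ℤ⟦X⟧), pow_mul (-1 : ℤ⟦X⟧), add_comm j.natAbs m]
  simp only [even_two, Even.neg_pow, one_pow, mul_one]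
  ring

/-! ### Support of the `x`-th summand -/

/-- The inner sum over `n ≤ x` in the expansion of `∑_k q^(k²) (q; q)_k² / (q; q)_{2k}` as
`∑_x (1 - q^(2x+1)) innerSum x`. -/
noncomputable def innerSum (x : ℕ) : ℤ⟦X⟧ :=
  ∑ n ∈ range (x + 1), X ^ (n ^ 2 + (x - n) ^ 2 + n * (x - n)) * qfac n * qfac (x + n) *
    qinv (x - n) * qinv (2 * n)

lemma innerSum_eq (x M : ℕ) (h : x ≤ M) :
    innerSum x = ∑ j ∈ Icc (-(M : ℤ)) M,
      X ^ (x ^ 2 + x * j + j * (j + 1) / 2 + j.natAbs * (j.natAbs + 1) / 2).toNat *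
        thetaSum j.natAbs (M + 1 - j.natAbs) := by
  have h1 : innerSum x = ∑ n ∈ range (M + 1), ∑ j ∈ Icc (-(n : ℤ)) n, tripleTerm x n j := by
    rw [innerSum, ← sum_subset (range_subset_range.2 (Nat.succ_le_succ h))]
    · refine sum_congr rfl fun n hn => ?_
      rw [sum_tripleTerm, if_pos (Nat.lt_succ_iff.1 (mem_range.1 hn))]
    · intro n _ hn
      rw [sum_tripleTerm, if_neg (by simpa using hn)]
  rw [h1]
  simp_rw [← sum_tripleTerm_left]
  refine sum_comm' fun n j => ?_
  simp only [mem_range, mem_Icc]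
  omega

lemma coeff_innerSum_ne_zero (x N : ℕ) (h : coeff N (innerSum x) ≠ 0) :
    ∃ (i : ℕ) (j δ : ℤ), (δ = 0 ∨ δ = 1) ∧ |j| ≤ i ∧
      (N : ℤ) = (x : ℤ) ^ 2 + ((i * (3 * i + 1) / 2 : ℕ) : ℤ) - j * (j - 1) / 2
        + (x : ℤ) * j + δ * (2 * (i : ℤ) + 1) := by
  rw [innerSum_eq x (max x N) (le_max_left _ _), map_sum] at h
  obtain ⟨j, hj, h⟩ := exists_ne_zero_of_sum_ne_zero h
  rw [coeff_X_pow_mul'] at h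
  have a1 := two_mul_ediv_two j
  have a2 := two_mul_ediv_two j.natAbs
  have a3 := two_mul_ediv_two (j - 1)
  have a5 : 0 ≤ (x : ℤ) ^ 2 + x * j + j * (j + 1) / 2 + j.natAbs * (j.natAbs + 1) / 2 -
      j.natAbs := by
    have hsq : (j.natAbs : ℤ) ^ 2 = j ^ 2 := Int.natAbs_sq j
    have hx : 0 ≤ (x : ℤ) * (x - 1) := by
      rcases x with _ | x
      · simp
      · push_cast
        nlinarith
    have hk : 0 ≤ (x : ℤ) ^ 2 + (x + j) ^ 2 + j ^ 2 + j - j.natAbs := by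
      rcases le_or_gt 0 j with hj0 | hj0
      · rw [Int.natAbs_of_nonneg hj0]
        nlinarith
      · rw [Int.ofNat_natAbs_of_nonpos hj0.le]
        rcases eq_or_ne j (-1) with rfl | hj1
        · linarith
        · nlinarith [show j ≤ -2 by omega, sq_nonneg (x : ℤ), sq_nonneg ((x : ℤ) + j)]
    linarith
  obtain ⟨e, he⟩ := Int.eq_ofNat_of_zero_le a5
  rw [show (x : ℤ) ^ 2 + x * j + j * (j + 1) / 2 + j.natAbs * (j.natAbs + 1) / 2 =
    (e + j.natAbs : ℕ) by rw [Nat.cast_add]; linarith, Int.toNat_natCast] at h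
  split_ifs at h with hN
  · obtain ⟨i, δ, hi, hδ, hE⟩ := coeff_thetaSum_ne_zero _ _ _ (by
      have := le_max_right x N
      omega) h
    refine ⟨i, j, δ, by omega, by rw [Int.abs_eq_natAbs]; exact_mod_cast hi, ?_⟩
    have a4 := Nat.two_mul_div_two_of_even (show Even (i * (3 * i + 1)) by
      rcases Nat.even_or_odd i with h | h
      · exact h.mul_right _
      · exact (((by decide : Odd 3).mul h).add_one).mul_left _)
    obtain ⟨d, rfl⟩ := Nat.exists_eq_add_of_le hN
    rw [Nat.add_sub_cancel_left] at hE
    have hsq : (j.natAbs : ℤ) ^ 2 = j ^ 2 := Int.natAbs_sq j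
    generalize i * (3 * i + 1) / 2 = T at *
    zify at hE a4
    rw [← Int.natCast_natAbs] at hE
    rw [sub_add_cancel, mul_comm (j - 1)] at a3
    rw [Nat.cast_add, Nat.cast_add]
    generalize j * (j + 1) / 2 = J at *
    generalize j * (j - 1) / 2 = J' at *
    generalize j.natAbs = k at *
    generalize (k : ℤ) * (k + 1) / 2 = K' at *
    nlinarith
  · simp at h

/-! ### The combined expansion -/

lemma coeff_sum_eq_coeff_innerSum (N : ℕ) :
    coeff N (∑ k ∈ range (N + 1), X ^ (k ^ 2) * qfac k ^ 2 * qinv (2 * k)) =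
      coeff N (∑ x ∈ range (N + 1), (1 - X ^ (2 * x + 1)) * innerSum x) := by
  have h1 : ∑ x ∈ range (N + 1), (1 - X ^ (2 * x + 1)) * innerSum x =
      ∑ n ∈ range (N + 1), X ^ (n ^ 2) * qfac n * qinv (2 * n) * wpSum n (N + 1 - n) := by
    simp_rw [innerSum, wpSum, mul_sum]
    rw [sum_sigma', sum_sigma']
    refine sum_bij' (fun p _ => ⟨p.2, p.1 - p.2⟩) (fun p _ => ⟨p.1 + p.2, p.1⟩) ?_ ?_ ?_ ?_ ?_
    · simp only [mem_sigma, mem_range]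
      omega
    · simp only [mem_sigma, mem_range]
      omega
    · rintro ⟨x, n⟩ h
      simp only [mem_sigma, mem_range] at h
      simp
      omega
    · rintro ⟨x, n⟩ h
      simp
    · rintro ⟨x, n⟩ h
      simp only [mem_sigma, mem_range] at h
      obtain ⟨y, rfl⟩ := Nat.exists_eq_add_of_le (Nat.lt_succ_iff.1 h.2)
      simp only [Nat.add_sub_cancel_left]
      rw [show n + y + n = 2 * n + y by ring]
      ring
  rw [h1, ← sub_eq_zero, ← map_sub, ← sum_sub_distrib]
  refine X_pow_dvd_iff.1 (dvd_sum fun n hn => ?_) N (Nat.lt_succ_self N)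
  obtain ⟨c, hc⟩ := X_pow_dvd_qinv_mul_wpSum_sub_one n (N + 1 - n)
  have h2 := qfac_mul_qinv n
  have : X ^ (n ^ 2) * qfac n ^ 2 * qinv (2 * n) -
      X ^ (n ^ 2) * qfac n * qinv (2 * n) * wpSum n (N + 1 - n) =
      X ^ (n ^ 2 + (N + 1 - n)) * (- c * qfac n ^ 2 * qinv (2 * n)) := by
    linear_combination (- X ^ (n ^ 2) * qfac n ^ 2 * qinv (2 * n)) * hc +
      (X ^ (n ^ 2) * qfac n * qinv (2 * n) * wpSum n (N + 1 - n)) * h2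
  rw [this]
  refine Dvd.dvd.mul_right (pow_dvd_pow _ ?_) _
  have := Nat.le_self_pow two_ne_zero n
  omega

lemma exists_ternary_of_coeff_ne_zero (N : ℕ)
    (h : coeff N (∑ k ∈ range (N + 1), X ^ (k ^ 2) * qfac k ^ 2 * qinv (2 * k)) ≠ 0) :
    ∃ (x i : ℕ) (j : ℤ) (ε δ : ℤ), ε ∈ ({0, 1} : Set ℤ) ∧ δ ∈ ({0, 1} : Set ℤ) ∧
      |j| ≤ (i : ℤ) ∧
      (N : ℤ) = (x : ℤ) ^ 2 + ((i * (3 * i + 1) / 2 : ℕ) : ℤ) - j * (j - 1) / 2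
        + (x : ℤ) * j + ε * (2 * (x : ℤ) + 1) + δ * (2 * (i : ℤ) + 1) := by
  rw [coeff_sum_eq_coeff_innerSum, map_sum] at h
  obtain ⟨x, -, h⟩ := exists_ne_zero_of_sum_ne_zero h
  rw [sub_mul, one_mul, map_sub, coeff_X_pow_mul'] at h
  by_cases h0 : coeff N (innerSum x) = 0
  · rw [h0, zero_sub, neg_ne_zero] at h
    split_ifs at h with hN
    · obtain ⟨i, j, δ, hδ, hj, hE⟩ := coeff_innerSum_ne_zero _ _ h
      refine ⟨x, i, j, 1, δ, by simp, hδ, hj, ?_⟩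
      rw [Nat.cast_sub hN] at hE
      push_cast at hE ⊢
      linarith
    · exact absurd rfl h
  · obtain ⟨i, j, δ, hδ, hj, hE⟩ := coeff_innerSum_ne_zero _ _ h0
    exact ⟨x, i, j, 0, δ, by simp, hδ, hj, by rw [hE]; ring⟩

/-! ### Generating functions of partitions with prescribed multiplicity weights -/

lemma coeff_prod_mk_eq_sum_partition (w : ℕ → ℕ → ℤ) {s : Finset ℕ} (hs : 0 ∉ s) (n : ℕ) :
    coeff n (∏ i ∈ s, mk fun d => if i ∣ d then w i (d / i) else 0) =
      ∑ p : n.Partition with ∀ x ∈ p.parts, x ∈ s, ∏ i ∈ s, w i (p.parts.count i) := by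
  rw [coeff_prod]
  simp only [coeff_mk]
  symm
  refine sum_of_injOn Nat.Partition.toFinsuppAntidiag
    (Nat.Partition.toFinsuppAntidiag_injective n).injOn ?_ ?_ ?_
  · intro p hp
    simp only [coe_filter, mem_univ, true_and, Set.mem_ofPred_eq] at hp
    have h := mem_finsuppAntidiag'.1 p.toFinsuppAntidiag_mem_finsuppAntidiag
    refine mem_finsuppAntidiag'.2 ⟨h.1, fun x hx => hp x ?_⟩
    simpa [Nat.Partition.toFinsuppAntidiag] using hx
  · intro g hg hg'
    by_contra hprod
    have hdvd : ∀ i, i ∣ g i := by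
      intro i
      by_cases hi : i ∈ s
      · by_contra h
        exact hprod (prod_eq_zero hi (if_neg h))
      · rw [show g i = 0 by
          by_contra h
          exact hi ((mem_finsuppAntidiag.1 hg).2 (by simpa using h))]
        exact dvd_zero i
    have hsupp : ∀ i, g i ≠ 0 → i ∈ s := fun i h =>
      (mem_finsuppAntidiag.1 hg).2 (by simpa using h)
    have hne : ∀ i, g i ≠ 0 → i ≠ 0 := fun i h h0 => hs (h0 ▸ hsupp i h)
    have hdiv : ∀ i, g i / i * i = g i := fun i => Nat.div_mul_cancel (hdvd i)
    refine hg' ⟨Nat.Partition.mk (Finsupp.mk g.support (fun i => g i / i) ?_).toMultiset ?_ ?_,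
      ?_, ?_⟩
    · intro i
      rw [Finsupp.mem_support_iff, not_iff_not]
      refine ⟨fun h => by simp [h], fun h => ?_⟩
      rw [← hdiv i, h, zero_mul]
    · suffices ∀ i, g i ≠ 0 → i ≠ 0 by simpa [Nat.pos_iff_ne_zero]
      exact hne
    · refine Eq.trans ?_ (mem_finsuppAntidiag'.1 hg).1
      simp [Finsupp.sum, hdiv]
    · suffices ∀ i, g i ≠ 0 → i ∈ s by simpa
      exact hsupp
    · ext i
      simpa [Nat.Partition.toFinsuppAntidiag] using hdiv i
  · intro p hp
    refine prod_congr rfl fun i hi => ?_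
    have : i ≠ 0 := fun h => hs (h ▸ hi)
    simp [Nat.Partition.toFinsuppAntidiag, Nat.pos_of_ne_zero this]

/-- The weight of `c` parts equal to `i`: the sign `(-1) ^ c` for `i ≤ k` if the multiplicity `c`
is admissible for `i`, zero if it is not, and one for `k < i`. -/
def partWeight (k i c : ℕ) : ℤ :=
  if i < k then if 2 ≤ c ∧ c ≤ 3 then (-1) ^ c else 0
  else if i = k then if 1 ≤ c ∧ c ≤ 2 then (-1) ^ c else 0
  else 1

lemma mk_partWeight_of_lt {k i : ℕ} (hi : 0 < i) (h : i < k) :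
    (mk fun d => if i ∣ d then partWeight k i (d / i) else 0) =
      X ^ (2 * i) * (1 - X ^ i) := by
  ext d
  rw [mul_sub, mul_one, ← pow_add]
  simp only [coeff_mk, map_sub, coeff_X_pow, partWeight, if_pos h]
  by_cases hd : i ∣ d
  · obtain ⟨c, rfl⟩ := hd
    rw [if_pos (dvd_mul_right i c), Nat.mul_div_cancel_left c hi, show 2 * i + i = i * 3 by ring,
      mul_comm 2 i]
    simp only [Nat.mul_right_inj hi.ne']
    by_cases h2 : c = 2
    · simp [h2]
    · by_cases h3 : c = 3
      · simp [h3]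
      · rw [if_neg (by omega), if_neg h2, if_neg h3, sub_zero]
  · rw [if_neg hd, if_neg (by rintro rfl; exact hd (dvd_mul_left i 2)),
      if_neg (by rintro rfl; exact hd ⟨3, by ring⟩), sub_zero]

lemma mk_partWeight_self {k : ℕ} (hk : 0 < k) :
    (mk fun d => if k ∣ d then partWeight k k (d / k) else 0) =
      -(X ^ k * (1 - X ^ k)) := by
  ext d
  rw [mul_sub, mul_one, ← pow_add]
  simp only [coeff_mk, map_sub, map_neg, coeff_X_pow, partWeight, lt_irrefl, if_true, if_false]
  by_cases hd : k ∣ d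
  · obtain ⟨c, rfl⟩ := hd
    rw [if_pos (dvd_mul_right k c), Nat.mul_div_cancel_left c hk, show k + k = k * 2 by ring]
    simp only [Nat.mul_right_inj hk.ne', Nat.mul_eq_left hk.ne']
    by_cases h1 : c = 1
    · simp [h1]
    · by_cases h2 : c = 2
      · simp [h2]
      · rw [if_neg (by omega), if_neg h1, if_neg h2, sub_zero, neg_zero]
  · rw [if_neg hd, if_neg (by rintro rfl; exact hd dvd_rfl),
      if_neg (by rintro rfl; exact hd ⟨2, by ring⟩), sub_zero, neg_zero]

lemma mk_partWeight_of_gt_mul {k i : ℕ} (h : k < i) :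
    (mk fun d => if i ∣ d then partWeight k i (d / i) else 0) * (1 - X ^ i) = 1 := by
  ext d
  rw [mul_sub, mul_one, map_sub, coeff_mul_X_pow']
  simp only [coeff_mk, partWeight, if_neg h.not_gt, if_neg h.ne', coeff_one]
  by_cases hd : i ≤ d
  · rw [if_pos hd, if_neg (by omega : d ≠ 0)]
    rcases hd.lt_or_eq with hd | rfl
    · simp [Nat.dvd_sub_self_right, hd.not_ge]
    · simp
  · rw [if_neg hd]
    by_cases h0 : d = 0
    · simp [h0]
    · rw [if_neg (fun h' => hd (Nat.le_of_dvd (Nat.pos_of_ne_zero h0) h')), if_neg h0, sub_zero]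

lemma prod_mk_partWeight_low (k j : ℕ) (h : j < k) :
    ∏ i ∈ range j, (mk fun d => if i + 1 ∣ d then partWeight k (i + 1) (d / (i + 1)) else 0) =
      X ^ (j ^ 2 + j) * qfac j := by
  induction j with
  | zero => simp
  | succ j ih =>
    rw [prod_range_succ, ih (by omega), mk_partWeight_of_lt (by omega) h, qfac_succ]
    ring

lemma prod_mk_partWeight {k : ℕ} (hk : 0 < k) :
    ∏ i ∈ Icc 1 (2 * k), (mk fun d => if i ∣ d then partWeight k i (d / i) else 0) =
      -(X ^ (k ^ 2) * qfac k ^ 2 * qinv (2 * k)) := by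
  rw [← Ico_add_one_right_eq_Icc, prod_Ico_eq_prod_range]
  obtain ⟨j, rfl⟩ := Nat.exists_eq_add_of_lt hk
  rw [show 2 * (0 + j + 1) + 1 - 1 = j + 1 + (j + 1) by omega, zero_add]
  rw [prod_range_add]
  simp only [add_comm 1]
  rw [prod_range_succ, prod_mk_partWeight_low _ _ (Nat.lt_succ_self j),
    mk_partWeight_self (Nat.add_pos_right j one_pos)]
  set P := ∏ x ∈ range (j + 1), (mk fun d => if j + 1 + x + 1 ∣ d then
    partWeight (j + 1) (j + 1 + x + 1) (d / (j + 1 + x + 1)) else 0) with hP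
  have h1 : P * ∏ s ∈ range (j + 1), (1 - X ^ (j + 1 + 1 + s)) = 1 := by
    rw [hP, ← prod_mul_distrib]
    refine prod_eq_one fun s _ => ?_
    rw [show j + 1 + 1 + s = j + 1 + s + 1 by ring, mk_partWeight_of_gt_mul (by omega)]
  have h2 := qfac_mul_prod (j + 1) (j + 1)
  have h3 := qfac_mul_qinv (2 * (j + 1))
  rw [two_mul] at h3 ⊢
  set Q := ∏ s ∈ range (j + 1), (1 - (X : ℤ⟦X⟧) ^ (j + 1 + 1 + s))
  have h4 : P = qfac (j + 1) * qinv (j + 1 + (j + 1)) := by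
    linear_combination (-P) * h3 + qfac (j + 1) * qinv (j + 1 + (j + 1)) * h1 -
      P * qinv (j + 1 + (j + 1)) * h2
  rw [h4, qfac_succ]
  ring

lemma card_filter_le_eq_sum_count {n : ℕ} (p : n.Partition) (k : ℕ) :
    Multiset.card (p.parts.filter (· ≤ k)) = ∑ i ∈ Icc 1 k, p.parts.count i := by
  rw [← Multiset.sum_count_eq_card (s := Icc 1 k)]
  · refine sum_congr rfl fun i hi => ?_
    exact Multiset.count_filter_of_pos (mem_Icc.1 hi).2
  · intro i hi
    rw [Multiset.mem_filter] at hi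
    exact mem_Icc.2 ⟨p.parts_pos hi.1, hi.2⟩

lemma prod_partWeight {k n : ℕ} (hk : 0 < k) (p : n.Partition) :
    ∏ i ∈ Icc 1 (2 * k), partWeight k i (p.parts.count i) =
      if 1 ≤ p.parts.count k ∧ p.parts.count k ≤ 2 ∧
        (∀ j, 1 ≤ j → j < k → 2 ≤ p.parts.count j ∧ p.parts.count j ≤ 3) then
        (-1) ^ Multiset.card (p.parts.filter (· ≤ k)) else 0 := by
  split_ifs with h
  · rw [card_filter_le_eq_sum_count, ← prod_pow_eq_pow_sum]
    symm
    refine prod_subset_one_on_sdiff (Icc_subset_Icc_right (by omega)) ?_ ?_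
    · intro i hi
      simp only [mem_sdiff, mem_Icc] at hi
      rw [partWeight, if_neg (by omega), if_neg (by omega)]
    · intro i hi
      rw [mem_Icc] at hi
      rcases hi.2.lt_or_eq with h' | rfl
      · rw [partWeight, if_pos h', if_pos (h.2.2 i hi.1 h')]
      · rw [partWeight, if_neg (lt_irrefl i), if_pos rfl, if_pos ⟨h.1, h.2.1⟩]
  · by_contra h0
    rw [← ne_eq, prod_ne_zero_iff] at h0
    refine h ⟨?_, ?_, fun j hj hjk => ?_⟩
    · have := h0 k (by simp; omega)
      simp [partWeight] at this
      omega
    · have := h0 k (by simp; omega)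
      simp [partWeight] at this
      omega
    · have := h0 j (by simp; omega)
      simp [partWeight, hjk] at this
      omega

lemma Abar_zero (m n : ℕ) : Abar 0 m n = 0 := by
  refine sum_eq_zero fun p hp => ?_
  simp only [mem_filter] at hp
  obtain ⟨-, -, h, -⟩ := hp
  have := p.parts_pos (Multiset.one_le_count_iff_mem.1 h)
  omega

lemma sum_Abar {k : ℕ} (hk : 0 < k) (n : ℕ) :
    ∑ m ∈ range (n + 1), Abar k m n = coeff n (X ^ (k ^ 2) * qfac k ^ 2 * qinv (2 * k)) := by
  classical
  rw [← neg_neg (X ^ (k ^ 2) * qfac k ^ 2 * qinv (2 * k)), ← prod_mk_partWeight hk, map_neg,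
    coeff_prod_mk_eq_sum_partition _ (by simp), ← sum_neg_distrib]
  simp only [Abar, prod_partWeight hk, sum_filter]
  rw [sum_comm]
  refine sum_congr rfl fun p _ => ?_
  have hcard : Multiset.card (p.parts.filter fun x => k + 1 ≤ x ∧ x ≤ 2 * k) ∈ range (n + 1) := by
    rw [mem_range, Nat.lt_succ_iff]
    refine (Multiset.card_le_card (Multiset.filter_le _ _)).trans ?_
    have := Multiset.card_nsmul_le_sum (s := p.parts) (a := 1) fun x hx => p.parts_pos hx
    simpa [p.parts_sum] using this
  rw [sum_eq_single_of_mem _ hcard]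
  · have hmem : (∀ x ∈ p.parts, x ∈ Icc 1 (2 * k)) ↔ ∀ x ∈ p.parts, x ≤ 2 * k :=
      forall₂_congr fun x hx => by simpa using fun _ => Nat.one_le_of_lt (p.parts_pos hx)
    by_cases h1 : ∀ x ∈ p.parts, x ≤ 2 * k
    · rw [if_pos (hmem.2 h1)]
      split_ifs with h h2 h2
      · rw [pow_succ, mul_neg_one]
      · exact absurd ⟨h.2.1, h.2.2.1, h.2.2.2.1⟩ h2
      · exact absurd ⟨h1, h2.1, h2.2.1, h2.2.2, rfl⟩ h
      · rw [neg_zero]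
    · rw [if_neg fun h => h1 h.1, if_neg fun h => h1 (hmem.1 h)]
  · intro m _ hm
    exact if_neg fun h => hm h.2.2.2.2.symm

lemma B_eq_coeff {n : ℕ} (hn : n ≠ 0) :
    B n = coeff n (∑ k ∈ range (n + 1), X ^ (k ^ 2) * qfac k ^ 2 * qinv (2 * k)) := by
  rw [map_sum, B]
  refine sum_congr rfl fun k _ => ?_
  rcases k.eq_zero_or_pos with rfl | hk
  · simp [Abar_zero, coeff_one, hn]
  · exact sum_Abar hk n

end Expansion

/-- If `B(N) ≠ 0` then `N` is represented by the ternary expansion coming from (2.8):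
`N = x² + i(3i+1)/2 − j(j−1)/2 + xj + ε(2x+1) + δ(2i+1)` for some `x, i ≥ 0`,
`j ∈ ℤ` with `|j| ≤ i`, and `ε, δ ∈ {0, 1}`. -/
theorem stmt10 (N : ℕ) (hN : B N ≠ 0) :
    ∃ (x i : ℕ) (j : ℤ) (ε δ : ℤ), ε ∈ ({0, 1} : Set ℤ) ∧ δ ∈ ({0, 1} : Set ℤ) ∧
      |j| ≤ (i : ℤ) ∧
      (N : ℤ) = (x : ℤ) ^ 2 + ((i * (3 * i + 1) / 2 : ℕ) : ℤ) - j * (j - 1) / 2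
        + (x : ℤ) * j + ε * (2 * (x : ℤ) + 1) + δ * (2 * (i : ℤ) + 1) := by
  rcases eq_or_ne N 0 with rfl | hN0
  · exact ⟨0, 0, 0, 0, 0, by simp⟩
  · exact exists_ternary_of_coeff_ne_zero N (B_eq_coeff hN0 ▸ hN)
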